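/- Let G be a concurrent stochastic game with a finite state set S, sink states ⊤ and ⊥, countable Max action sets, B(s) finite for every s, and suppose ⊥ is the only state with val(Reach(⊤), ·) = 0. Let S_0 be the set of states from which Max has an optimal strategy for Reach(⊤) and S_0^+ := S_0 \ {⊥}. Define R(0) := {⊤}, and for n ≥ 0 let R(n+1) be R(n) together with all states s ∈ S_0 for which there exist an optimality-preserving mixed Max action α_s at s and δ_s > 0 such that p(s,α_s,b)(R(n)) ≥ δ_s for every value-preserving Min action b ∈ B(s); set R := R(|S|−1). Then R = S_0^+. -/

import Mathlib

open scoped ENNReal Classical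

/-- One step of a play: a state together with the actions chosen by Max and Min there. -/
structure Step (S A B : Type) where
  st : S
  ac : A
  bc : B

instance {S A B : Type} : MeasurableSpace (Step S A B) := ⊤

/-- A history: the list of past steps together with the current (final) state. -/
abbrev Hist (S A B : Type) := List (Step S A B) × S

/-- An infinite play. -/
abbrev Play (S A B : Type) := ℕ → Step S A B

/-- A concurrent stochastic game: action sets for Max and Min at each state
(nonempty; countability is imposed via `Countable` instances on `S`, `A`, `B`),
and a transition probability distribution for each state and pair of actions. -/
structure Game (S A B : Type) where
  actA : S → Set A
  actB : S → Set B
  actA_nonempty : ∀ s, (actA s).Nonempty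
  actB_nonempty : ∀ s, (actB s).Nonempty
  p : S → A → B → PMF S

namespace Game

variable {S A B : Type}

/-- A Max strategy assigns to each history a mixed action on the Max actions
available at the final state of the history. -/
def IsMaxStrategy (G : Game S A B) (σ : Hist S A B → PMF A) : Prop :=
  ∀ h : Hist S A B, (σ h).support ⊆ G.actA h.2

/-- A Min strategy assigns to each history a mixed action on the Min actions
available at the final state of the history. -/
def IsMinStrategy (G : Game S A B) (π : Hist S A B → PMF B) : Prop :=
  ∀ h : Hist S A B, (π h).support ⊆ G.actB h.2

/-- A sink state: all transitions from it return to it with probability 1. -/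
def IsSink (G : Game S A B) (s : S) : Prop := ∀ a b, G.p s a b s = 1

/-- A history is valid if all actions taken in it were available. -/
def ValidHist (G : Game S A B) (h : Hist S A B) : Prop :=
  ∀ z ∈ h.1, z.ac ∈ G.actA z.st ∧ z.bc ∈ G.actB z.st

/-- Transition function extended to a mixed Max action and a pure Min action. -/
noncomputable def pA (G : Game S A B) (s : S) (α : PMF A) (b : B) : PMF S :=
  α.bind fun a => G.p s a b

/-- Transition function extended to mixed actions of both players. -/
noncomputable def pAB (G : Game S A B) (s : S) (α : PMF A) (β : PMF B) : PMF S :=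
  α.bind fun a => β.bind fun b => G.p s a b

/-- The state reached after the current position: the state of the next listed
step, or the given final state if no steps remain. -/
def nextState : List (Step S A B) → S → S
  | [], t => t
  | z :: _, _ => z.st

/-- Auxiliary recursion computing the probability of a history:
`pre` is the already-consumed prefix, `cur` the current state, and the
remaining steps and final state are processed from the left. -/
noncomputable def histProbAux (G : Game S A B)
    (σ : Hist S A B → PMF A) (π : Hist S A B → PMF B) :
    List (Step S A B) → S → List (Step S A B) → S → ℝ≥0∞
  | _, cur, [], t => if t = cur then 1 else 0
  | pre, cur, z :: rest, t =>
    if z.st = cur then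
      σ (pre, cur) z.ac * π (pre, cur) z.bc *
        G.p z.st z.ac z.bc (nextState rest t) *
        histProbAux G σ π (pre ++ [z]) (nextState rest t) rest t
    else 0

/-- The probability of (the cylinder of) a history under strategies σ, π from
initial state `s0`. -/
noncomputable def histProb (G : Game S A B)
    (σ : Hist S A B → PMF A) (π : Hist S A B → PMF B) (s0 : S) (h : Hist S A B) : ℝ≥0∞ :=
  G.histProbAux σ π [] s0 h.1 h.2

end Game

/-- The cylinder set of plays extending a given history. -/
def cylinder {S A B : Type} (h : Hist S A B) : Set (Play S A B) :=
  {ω | (∀ i : Fin h.1.length, ω i = h.1.get i) ∧ (ω h.1.length).st = h.2}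

/-- A strategy is memoryless if its choice depends only on the final state. -/
def Memoryless {S A B X : Type} (σ : Hist S A B → X) : Prop :=
  ∀ h h' : Hist S A B, h.2 = h'.2 → σ h = σ h'

/-- The event that the play visits state `t`. -/
def Reaches {S A B : Type} (t : S) : Set (Play S A B) := {ω | ∃ i, (ω i).st = t}

/-- The event that the play never visits state `t`. -/
def Avoids {S A B : Type} (t : S) : Set (Play S A B) := {ω | ∀ i, (ω i).st ≠ t}

/-- The event that the play visits state `t` within at most `n` steps. -/
def ReachesWithin {S A B : Type} (t : S) (n : ℕ) : Set (Play S A B) :=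
  {ω | ∃ i ≤ n, (ω i).st = t}

/-- Expectation of `v : S → ℝ≥0∞` with respect to a distribution on `S`. -/
noncomputable def expE {S : Type} (μ : PMF S) (v : S → ℝ≥0∞) : ℝ≥0∞ := ∑' t, μ t * v t

/-- Expectation of a real-valued `v` with respect to a distribution on `S`. -/
noncomputable def expR {S : Type} (μ : PMF S) (v : S → ℝ) : ℝ := ∑' t, (μ t).toReal * v t

/-- The mass a distribution assigns to a set of states. -/
noncomputable def massOf {S : Type} (μ : PMF S) (T : Set S) : ℝ≥0∞ :=
  ∑' t, T.indicator (⇑μ) t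

namespace Game

variable {S A B : Type}

/-- `μ` is the probability measure on plays induced by strategies σ, π from
initial state `s0` (characterized on cylinder sets, by Carathéodory's
extension theorem). -/
def IsPlayMeasure (G : Game S A B) (σ : Hist S A B → PMF A) (π : Hist S A B → PMF B)
    (s0 : S) (μ : MeasureTheory.Measure (Play S A B)) : Prop :=
  MeasureTheory.IsProbabilityMeasure μ ∧
    ∀ h : Hist S A B, μ (cylinder h) = G.histProb σ π s0 h

/-- The (lower) value `sup_σ inf_π P_{s,σ,π}(E)` of objective `E` from state `s`,
relative to the family `P` of induced play measures. -/
noncomputable def val (G : Game S A B)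
    (P : (Hist S A B → PMF A) → (Hist S A B → PMF B) → S →
      MeasureTheory.Measure (Play S A B))
    (E : Set (Play S A B)) (s : S) : ℝ≥0∞ :=
  ⨆ σ ∈ {σ | G.IsMaxStrategy σ}, ⨅ π ∈ {π | G.IsMinStrategy π}, P σ π s E

/-- The set of states from which Max has an optimal strategy for `Reaches top`. -/
def OptStates (G : Game S A B)
    (P : (Hist S A B → PMF A) → (Hist S A B → PMF B) → S →
      MeasureTheory.Measure (Play S A B))
    (top : S) : Set S :=
  {s | ∃ σ, G.IsMaxStrategy σ ∧ ∀ π, G.IsMinStrategy π →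
      P σ π s (Reaches top) ≥ G.val P (Reaches top) s}

/-- A mixed Max action `α` at `s` is optimality-preserving if every Min action
gives expected value at least the value of `s`, and in case of equality the
successor distribution is supported on states admitting optimal strategies. -/
def OptPreserving (G : Game S A B)
    (P : (Hist S A B → PMF A) → (Hist S A B → PMF B) → S →
      MeasureTheory.Measure (Play S A B))
    (top : S) (s : S) (α : PMF A) : Prop :=
  ∀ b ∈ G.actB s,
    G.val P (Reaches top) s ≤ expE (G.pA s α b) (G.val P (Reaches top)) ∧
    (expE (G.pA s α b) (G.val P (Reaches top)) = G.val P (Reaches top) s →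
      (G.pA s α b).support ⊆ G.OptStates P top)

/-- A Min action `b` is value-preserving at `s` against the mixed action `α`. -/
def ValuePres (G : Game S A B)
    (P : (Hist S A B → PMF A) → (Hist S A B → PMF B) → S →
      MeasureTheory.Measure (Play S A B))
    (top : S) (s : S) (α : PMF A) (b : B) : Prop :=
  expE (G.pA s α b) (G.val P (Reaches top)) = G.val P (Reaches top) s

end Game

namespace Game

variable {S A B : Type}

/-- The probability of visiting `top` when play continues from the history `(pre, s)`,
summed over the histories that visit `top` for the first time at their end. -/
noncomputable def reachProb (G : Game S A B) (top : S)
    (σ : Hist S A B → PMF A) (π : Hist S A B → PMF B) (pre : List (Step S A B)) (s : S) : ℝ≥0∞ :=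
  ∑' l : List (Step S A B),
    if ∀ z ∈ l, z.st ≠ top then G.histProbAux σ π pre s l top else 0

/-- The strategy that plays as if `pre` had already happened. -/
def shift {X : Type} (σ : Hist S A B → X) (pre : List (Step S A B)) : Hist S A B → X :=
  fun h => σ (pre ++ h.1, h.2)

theorem measurableSet_cylinder (h : Hist S A B) : MeasurableSet (cylinder h) := by
  have h1 : MeasurableSet {ω : Play S A B | ∀ i : Fin h.1.length, ω i = h.1.get i} := by
    rw [Set.ofPred_forall]
    refine MeasurableSet.iInter fun i => ?_
    have hi : Measurable fun ω : Play S A B => ω i := measurable_pi_apply _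
    exact hi (MeasurableSpace.measurableSet_top (s := {h.1.get i}))
  have h2 : MeasurableSet {ω : Play S A B | (ω h.1.length).st = h.2} := by
    have hl : Measurable fun ω : Play S A B => ω h.1.length := measurable_pi_apply _
    exact hl (MeasurableSpace.measurableSet_top (s := {z : Step S A B | z.st = h.2}))
  exact h1.inter h2

theorem countable_step [Countable S] [Countable A] [Countable B] : Countable (Step S A B) :=
  Function.Injective.countable (f := fun z : Step S A B => (z.st, z.ac, z.bc)) (by
    rintro ⟨s, a, b⟩ ⟨s', a', b'⟩ h
    simp_all)

theorem reaches_eq_iUnion (top : S) :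
    Reaches top = ⋃ l : {l : List (Step S A B) // ∀ z ∈ l, z.st ≠ top}, cylinder (l.1, top) := by
  ext ω
  simp only [Reaches, Set.mem_ofPred_eq, Set.mem_iUnion]
  constructor
  · intro h
    refine ⟨⟨List.ofFn fun i : Fin (Nat.find h) => ω i, ?_⟩, ?_, ?_⟩
    · intro z hz
      obtain ⟨i, rfl⟩ := List.mem_ofFn.1 hz
      exact Nat.find_min h i.2
    · intro i
      simp
    · simpa using Nat.find_spec h
  · rintro ⟨l, hl⟩
    exact ⟨_, hl.2⟩

theorem length_le_of_mem_cylinder {top : S} {l l' : List (Step S A B)} {ω : Play S A B}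
    (hl' : ∀ z ∈ l', z.st ≠ top) (h : ω ∈ cylinder (l, top)) (h' : ω ∈ cylinder (l', top)) :
    l'.length ≤ l.length := by
  by_contra! hlt
  have h1 := h'.1 ⟨l.length, hlt⟩
  have h2 := h.2
  simp only at h1 h2
  rw [h1] at h2
  exact hl' _ (List.get_mem _ _) h2

theorem pairwise_disjoint_cylinder (top : S) :
    Pairwise (Function.onFun Disjoint
      fun l : {l : List (Step S A B) // ∀ z ∈ l, z.st ≠ top} => cylinder (l.1, top)) := by
  rintro ⟨l, hl⟩ ⟨l', hl'⟩ hne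
  refine Set.disjoint_left.2 fun ω h h' => hne (Subtype.ext ?_)
  have hlen := le_antisymm (length_le_of_mem_cylinder hl h' h) (length_le_of_mem_cylinder hl' h h')
  refine List.ext_get hlen fun n h1 h2 => ?_
  exact (h.1 ⟨n, h1⟩).symm.trans (h'.1 ⟨n, h2⟩)

theorem IsPlayMeasure.reaches_eq [Countable S] [Countable A] [Countable B] {G : Game S A B}
    {σ : Hist S A B → PMF A} {π : Hist S A B → PMF B} {s : S}
    {μ : MeasureTheory.Measure (Play S A B)} (hμ : G.IsPlayMeasure σ π s μ) (top : S) :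
    μ (Reaches top) = G.reachProb top σ π [] s := by
  have := countable_step (S := S) (A := A) (B := B)
  rw [reaches_eq_iUnion, MeasureTheory.measure_iUnion (pairwise_disjoint_cylinder top)
    fun l => measurableSet_cylinder _]
  simp only [hμ.2]
  refine (tsum_subtype {l : List (Step S A B) | ∀ z ∈ l, z.st ≠ top}
    fun l => G.histProb σ π s (l, top)).trans ?_
  refine tsum_congr fun l => ?_
  simp [Set.indicator_apply, histProb]

theorem histProbAux_congr (G : Game S A B) {σ σ' : Hist S A B → PMF A} {π π' : Hist S A B → PMF B}
    (l : List (Step S A B)) (t : S) : ∀ (pre pre' : List (Step S A B)) (s : S),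
    (∀ l' s', nextState l' s' = s → σ (pre ++ l', s') = σ' (pre' ++ l', s')) →
    (∀ l' s', nextState l' s' = s → π (pre ++ l', s') = π' (pre' ++ l', s')) →
    G.histProbAux σ π pre s l t = G.histProbAux σ' π' pre' s l t := by
  induction l with
  | nil => intros; rfl
  | cons z rest ih =>
    intro pre pre' s hσ hπ
    by_cases hz : z.st = s
    · have h1 := hσ [] s rfl
      have h2 := hπ [] s rfl
      simp only [List.append_nil] at h1 h2
      simp only [histProbAux, hz, if_true, h1, h2]
      rw [ih (pre ++ [z]) (pre' ++ [z])]
      · intro l' s' _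
        simpa using hσ (z :: l') s' hz
      · intro l' s' _
        simpa using hπ (z :: l') s' hz
    · simp [histProbAux, hz]

theorem reachProb_congr (G : Game S A B) (top : S) {σ σ' : Hist S A B → PMF A}
    {π π' : Hist S A B → PMF B} {pre pre' : List (Step S A B)} {s : S}
    (hσ : ∀ l' s', nextState l' s' = s → σ (pre ++ l', s') = σ' (pre' ++ l', s'))
    (hπ : ∀ l' s', nextState l' s' = s → π (pre ++ l', s') = π' (pre' ++ l', s')) :
    G.reachProb top σ π pre s = G.reachProb top σ' π' pre' s :=
  tsum_congr fun l => by rw [histProbAux_congr G l top pre pre' s hσ hπ]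

theorem histProbAux_eq_zero (G : Game S A B) {σ : Hist S A B → PMF A} {π : Hist S A B → PMF B}
    {pre l : List (Step S A B)} {s t : S} (h : s ≠ nextState l t) :
    G.histProbAux σ π pre s l t = 0 := by
  cases l with
  | nil => simp [histProbAux, nextState] at *; exact fun h' => h h'.symm
  | cons z rest => simp [histProbAux, nextState] at *; exact fun h' => (h h'.symm).elim

theorem reachProb_self (G : Game S A B) (top : S) (σ : Hist S A B → PMF A)
    (π : Hist S A B → PMF B) (pre : List (Step S A B)) : G.reachProb top σ π pre top = 1 := by
  rw [reachProb, tsum_eq_single []]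
  · simp [histProbAux]
  · intro l hl
    cases l with
    | nil => exact (hl rfl).elim
    | cons z rest =>
      by_cases hz : z.st = top
      · simp [hz]
      · simp [histProbAux, hz]

theorem reachProb_step (G : Game S A B) {top s : S} (hs : s ≠ top) (σ : Hist S A B → PMF A)
    (π : Hist S A B → PMF B) (pre : List (Step S A B)) :
    G.reachProb top σ π pre s = ∑' a, ∑' b, σ (pre, s) a * π (pre, s) b *
      ∑' t, G.p s a b t * G.reachProb top σ π (pre ++ [⟨s, a, b⟩]) t := by
  have hinj : Function.Injective
      fun x : A × B × List (Step S A B) => (⟨s, x.1, x.2.1⟩ :: x.2.2 : List (Step S A B)) := by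
    rintro ⟨a, b, l⟩ ⟨a', b', l'⟩ h
    simp_all
  rw [reachProb, ← hinj.tsum_eq]
  · rw [ENNReal.tsum_prod']
    refine tsum_congr fun a => ?_
    rw [ENNReal.tsum_prod']
    refine tsum_congr fun b => ?_
    simp only [reachProb, ← ENNReal.tsum_mul_left]
    rw [ENNReal.tsum_comm]
    refine tsum_congr fun l => ?_
    rw [tsum_eq_single (nextState l top)]
    · by_cases hl : ∀ z ∈ l, z.st ≠ top
      · rw [if_pos hl, if_pos (by simpa [hs] using hl)]
        simp [histProbAux, mul_assoc]
      · rw [if_neg hl, if_neg (by simpa [hs] using hl)]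
        simp
    · intro t ht
      simp [histProbAux_eq_zero G ht]
  · intro l hl
    cases l with
    | nil => simp [histProbAux, hs.symm] at hl
    | cons z rest =>
      by_cases hz : z.st = s
      · subst hz
        exact ⟨(z.ac, z.bc, rest), rfl⟩
      · simp [histProbAux, hz] at hl

/-- The least probability of visiting `top` from `s` that `σ` guarantees. -/
noncomputable def guarantee (G : Game S A B) (top : S) (σ : Hist S A B → PMF A) (s : S) : ℝ≥0∞ :=
  ⨅ π ∈ {π | G.IsMinStrategy π}, G.reachProb top σ π [] s

theorem IsMaxStrategy.shift {G : Game S A B} {σ : Hist S A B → PMF A} (hσ : G.IsMaxStrategy σ)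
    (pre : List (Step S A B)) : G.IsMaxStrategy (Game.shift σ pre) :=
  fun h => hσ (pre ++ h.1, h.2)

theorem exists_isMinStrategy (G : Game S A B) : ∃ π, G.IsMinStrategy π :=
  ⟨fun h => PMF.pure (G.actB_nonempty h.2).some, fun h => by
    simpa using (G.actB_nonempty h.2).some_mem⟩

theorem exists_isMaxStrategy (G : Game S A B) : ∃ σ, G.IsMaxStrategy σ :=
  ⟨fun h => PMF.pure (G.actA_nonempty h.2).some, fun h => by
    simpa using (G.actA_nonempty h.2).some_mem⟩

theorem expE_pA (G : Game S A B) (s : S) (α : PMF A) (b : B) (v : S → ℝ≥0∞) :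
    expE (G.pA s α b) v = ∑' a, α a * ∑' t, G.p s a b t * v t := by
  simp only [expE, pA, PMF.bind_apply, ← ENNReal.tsum_mul_right, ← ENNReal.tsum_mul_left]
  rw [ENNReal.tsum_comm]
  simp only [mul_assoc]

/-- Min can play `b` first and then respond almost optimally to the rest of `σ`. -/
theorem guarantee_le_step (G : Game S A B) {top s : S} (hs : s ≠ top) (σ : Hist S A B → PMF A)
    {b : B} (hb : b ∈ G.actB s)
    (hfin : ∀ a t, G.guarantee top (shift σ [⟨s, a, b⟩]) t ≠ ∞) :
    G.guarantee top σ s ≤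
      ∑' a, σ ([], s) a * ∑' t, G.p s a b t * G.guarantee top (shift σ [⟨s, a, b⟩]) t := by
  refine ENNReal.le_of_forall_pos_le_add fun ε hε _ => ?_
  have hex : ∀ a t, ∃ π, G.IsMinStrategy π ∧ G.reachProb top (shift σ [⟨s, a, b⟩]) π [] t ≤
      G.guarantee top (shift σ [⟨s, a, b⟩]) t + ε := by
    intro a t
    have hlt := ENNReal.lt_add_right (hfin a t) (ENNReal.coe_ne_zero.2 hε.ne')
    conv_lhs at hlt => rw [guarantee]
    simp only [iInf_lt_iff] at hlt
    obtain ⟨π, hπ, h⟩ := hlt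
    exact ⟨π, hπ, h.le⟩
  choose ρ hρ hle using hex
  obtain ⟨π₀, hπ₀⟩ := G.exists_isMinStrategy
  let π : Hist S A B → PMF B := fun h => match h.1 with
    | [] => if h.2 = s then PMF.pure b else π₀ h
    | z :: l => ρ z.ac (nextState l h.2) (l, h.2)
  have hπ : G.IsMinStrategy π := by
    rintro ⟨l, s'⟩
    cases l with
    | nil =>
      by_cases h : s' = s
      · subst h
        simpa [π] using hb
      · simpa [π, h] using hπ₀ ([], s')
    | cons z l => exact hρ _ _ (l, s')
  have hstep : ∀ a t, G.reachProb top σ π [⟨s, a, b⟩] t =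
      G.reachProb top (shift σ [⟨s, a, b⟩]) (ρ a t) [] t := fun a t =>
    reachProb_congr G top (fun _ _ _ => rfl) fun l' s' h => by simp [π, h]
  calc G.guarantee top σ s ≤ G.reachProb top σ π [] s := iInf₂_le π hπ
    _ = ∑' a, σ ([], s) a * ∑' t, G.p s a b t *
          G.reachProb top (shift σ [⟨s, a, b⟩]) (ρ a t) [] t := by
        rw [reachProb_step G hs]
        refine tsum_congr fun a => ?_
        rw [tsum_eq_single b]
        · simp [π, ← hstep]
        · intro b' hb'
          simp [π, hb']
    _ ≤ ∑' a, σ ([], s) a * ∑' t, G.p s a b t *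
          (G.guarantee top (shift σ [⟨s, a, b⟩]) t + ε) := by
        gcongr with a t
        exact hle a t
    _ = _ := by
        simp only [mul_add, ENNReal.tsum_add, ENNReal.tsum_mul_right, PMF.tsum_coe, one_mul]

theorem val_le_one {G : Game S A B} {top : S}
    {P : (Hist S A B → PMF A) → (Hist S A B → PMF B) → S → MeasureTheory.Measure (Play S A B)}
    (hP : ∀ σ π s, G.IsMaxStrategy σ → G.IsMinStrategy π →
      G.IsPlayMeasure σ π s (P σ π s)) (s : S) : G.val P (Reaches top) s ≤ 1 := by
  obtain ⟨π, hπ⟩ := G.exists_isMinStrategy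
  refine iSup₂_le fun σ hσ => iInf₂_le_of_le π hπ ?_
  have := (hP σ π s hσ hπ).1
  exact MeasureTheory.prob_le_one

theorem massOf_eq_zero_iff (μ : PMF S) (T : Set S) : massOf μ T = 0 ↔ ∀ t ∈ T, μ t = 0 := by
  simp [massOf, ENNReal.tsum_eq_zero, Set.indicator_apply]

theorem exists_pos_le_of_finite {X : Type} {F : Set X} (hF : F.Finite) (f : X → ℝ≥0∞)
    (h : ∀ x ∈ F, f x ≠ 0) : ∃ δ, 0 < δ ∧ ∀ x ∈ F, δ ≤ f x := by
  rcases F.eq_empty_or_nonempty with rfl | hne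
  · exact ⟨1, by simp, by simp⟩
  · obtain ⟨x, hx, hmin⟩ := hF.exists_minimalFor f F hne
    refine ⟨f x, pos_iff_ne_zero.2 (h x hx), fun y hy => ?_⟩
    exact (le_total (f x) (f y)).elim id (hmin hy)

section Optimal

variable [Countable S] [Countable A] [Countable B] {G : Game S A B} {top : S}
  {P : (Hist S A B → PMF A) → (Hist S A B → PMF B) → S → MeasureTheory.Measure (Play S A B)}

theorem iInf_reaches_eq (hP : ∀ σ π s, G.IsMaxStrategy σ → G.IsMinStrategy π →
      G.IsPlayMeasure σ π s (P σ π s)) {σ : Hist S A B → PMF A} (hσ : G.IsMaxStrategy σ) (s : S) :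
    ⨅ π ∈ {π | G.IsMinStrategy π}, P σ π s (Reaches top) = G.guarantee top σ s :=
  biInf_congr fun π hπ => (hP σ π s hσ hπ).reaches_eq top

theorem guarantee_le_val (hP : ∀ σ π s, G.IsMaxStrategy σ → G.IsMinStrategy π →
      G.IsPlayMeasure σ π s (P σ π s)) {σ : Hist S A B → PMF A} (hσ : G.IsMaxStrategy σ) (s : S) :
    G.guarantee top σ s ≤ G.val P (Reaches top) s := by
  rw [← iInf_reaches_eq hP hσ]
  exact le_iSup₂_of_le σ hσ le_rfl

theorem mem_optStates_iff (hP : ∀ σ π s, G.IsMaxStrategy σ → G.IsMinStrategy π →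
      G.IsPlayMeasure σ π s (P σ π s)) {s : S} : s ∈ G.OptStates P top ↔
      ∃ σ, G.IsMaxStrategy σ ∧ G.val P (Reaches top) s ≤ G.guarantee top σ s := by
  refine exists_congr fun σ => and_congr_right fun hσ => ?_
  rw [← iInf_reaches_eq hP hσ]
  simp

theorem val_self (hP : ∀ σ π s, G.IsMaxStrategy σ → G.IsMinStrategy π →
      G.IsPlayMeasure σ π s (P σ π s)) : G.val P (Reaches top) top = 1 := by
  obtain ⟨σ, hσ⟩ := G.exists_isMaxStrategy
  refine le_antisymm (val_le_one hP top) (le_trans ?_ (guarantee_le_val hP hσ top))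
  exact le_iInf₂ fun π _ => (reachProb_self G top σ π []).ge

theorem top_mem_optStates (hP : ∀ σ π s, G.IsMaxStrategy σ → G.IsMinStrategy π →
      G.IsPlayMeasure σ π s (P σ π s)) : top ∈ G.OptStates P top := by
  obtain ⟨σ, hσ⟩ := G.exists_isMaxStrategy
  refine (mem_optStates_iff hP).2 ⟨σ, hσ, (val_le_one hP top).trans ?_⟩
  exact le_iInf₂ fun π _ => (reachProb_self G top σ π []).ge

theorem val_le_expE (hP : ∀ σ π s, G.IsMaxStrategy σ → G.IsMinStrategy π →
      G.IsPlayMeasure σ π s (P σ π s)) {σ : Hist S A B → PMF A} (hσ : G.IsMaxStrategy σ) {s : S}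
    (hs : s ≠ top) (hopt : G.val P (Reaches top) s ≤ G.guarantee top σ s) {b : B}
    (hb : b ∈ G.actB s) :
    G.val P (Reaches top) s ≤ expE (G.pA s (σ ([], s)) b) (G.val P (Reaches top)) ∧
    (G.ValuePres P top s (σ ([], s)) b → ∀ a t, σ ([], s) a ≠ 0 → G.p s a b t ≠ 0 →
      G.val P (Reaches top) t ≤ G.guarantee top (shift σ [⟨s, a, b⟩]) t) := by
  have hle : ∀ a t, G.guarantee top (shift σ [⟨s, a, b⟩]) t ≤ G.val P (Reaches top) t :=
    fun a t => guarantee_le_val hP (hσ.shift _) t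
  have hstep := hopt.trans (guarantee_le_step G hs σ hb fun a t =>
    ne_top_of_le_ne_top ENNReal.one_ne_top ((hle a t).trans (val_le_one hP t)))
  refine ⟨?_, fun hvp a t ha ht => ?_⟩
  · refine hstep.trans ?_
    rw [expE_pA]
    gcongr with a t
    exact hle a t
  · rw [ValuePres, expE_pA] at hvp
    rw [← hvp] at hstep
    have hfin : ∑' a, σ ([], s) a * ∑' t, G.p s a b t * G.val P (Reaches top) t ≠ ∞ :=
      hvp ▸ ne_top_of_le_ne_top ENNReal.one_ne_top (val_le_one hP s)
    by_contra! hlt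
    refine absurd hstep (not_le.2 ?_)
    have hinner : ∑' t, G.p s a b t * G.guarantee top (shift σ [⟨s, a, b⟩]) t <
        ∑' t, G.p s a b t * G.val P (Reaches top) t := by
      refine ENNReal.tsum_lt_tsum (i := t) ?_ (fun t => by gcongr; exact hle a t) ?_
      · refine ne_top_of_le_ne_top ENNReal.one_ne_top ?_
        calc ∑' t, G.p s a b t * G.guarantee top (shift σ [⟨s, a, b⟩]) t
            ≤ ∑' t, G.p s a b t * 1 := by
              gcongr with t
              exact (hle a t).trans (val_le_one hP t)
          _ = 1 := by simp
      · exact ENNReal.mul_lt_mul_right ht (PMF.apply_ne_top _ _) hlt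
    refine ENNReal.tsum_lt_tsum (i := a) ?_ (fun a => ?_) ?_
    · refine ne_top_of_le_ne_top hfin ?_
      gcongr with a t
      exact hle a t
    · gcongr with t
      exact hle a t
    · exact ENNReal.mul_lt_mul_right ha (PMF.apply_ne_top _ _) hinner

theorem optPreserving_of_optimal (hP : ∀ σ π s, G.IsMaxStrategy σ → G.IsMinStrategy π →
      G.IsPlayMeasure σ π s (P σ π s)) {σ : Hist S A B → PMF A} (hσ : G.IsMaxStrategy σ) {s : S}
    (hs : s ≠ top) (hopt : G.val P (Reaches top) s ≤ G.guarantee top σ s) :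
    G.OptPreserving P top s (σ ([], s)) := by
  intro b hb
  obtain ⟨h1, h2⟩ := val_le_expE hP hσ hs hopt hb
  refine ⟨h1, fun hvp t ht => ?_⟩
  obtain ⟨a, ha, hat⟩ := (PMF.mem_support_bind_iff _ _ _).1 ht
  exact (mem_optStates_iff hP).2 ⟨_, hσ.shift _, h2 hvp a t ha hat⟩

/-- If every optimality-preserving action outside `T ∋ top` can be answered by a value-preserving
action that avoids `T`, then optimal strategies outside `T` never reach `top`. -/
theorem val_eq_zero_of_avoid (hP : ∀ σ π s, G.IsMaxStrategy σ → G.IsMinStrategy π →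
      G.IsPlayMeasure σ π s (P σ π s)) {T : Set S} (hT : top ∈ T)
    (havoid : ∀ s ∈ G.OptStates P top, s ∉ T → ∀ α : PMF A, α.support ⊆ G.actA s →
      G.OptPreserving P top s α →
      ∃ b ∈ G.actB s, G.ValuePres P top s α b ∧ massOf (G.pA s α b) T = 0)
    {s : S} (hs : s ∈ G.OptStates P top) (hsT : s ∉ T) : G.val P (Reaches top) s = 0 := by
  obtain ⟨σ, hσ, hopt⟩ := (mem_optStates_iff hP).1 hs
  have hex : ∀ h : Hist S A B, ∃ b ∈ G.actB h.2,
      (∃ b ∈ G.actB h.2, G.ValuePres P top h.2 (σ h) b ∧ massOf (G.pA h.2 (σ h) b) T = 0) →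
      G.ValuePres P top h.2 (σ h) b ∧ massOf (G.pA h.2 (σ h) b) T = 0 := by
    intro h
    by_cases hg : ∃ b ∈ G.actB h.2,
      G.ValuePres P top h.2 (σ h) b ∧ massOf (G.pA h.2 (σ h) b) T = 0
    · obtain ⟨b, hb, hb'⟩ := hg
      exact ⟨b, hb, fun _ => hb'⟩
    · obtain ⟨b, hb⟩ := G.actB_nonempty h.2
      exact ⟨b, hb, fun h' => (hg h').elim⟩
  choose β hβ hβ' using hex
  have hπ : G.IsMinStrategy fun h => PMF.pure (β h) := fun h => by simpa using hβ h
  have hzero : ∀ (l pre : List (Step S A B)) (s : S), s ∉ T →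
      G.val P (Reaches top) s ≤ G.guarantee top (shift σ pre) s →
      G.histProbAux σ (fun h => PMF.pure (β h)) pre s l top = 0 := by
    intro l
    induction l with
    | nil =>
      intro pre s hsT _
      have : top ≠ s := fun h => hsT (h ▸ hT)
      simp [histProbAux, this]
    | cons z rest ih =>
      intro pre s hsT hopt
      have hst : s ≠ top := fun h => hsT (h ▸ hT)
      by_contra hne
      obtain ⟨zs, a, b⟩ := z
      by_cases hz : zs = s
      swap
      · simp [histProbAux, hz] at hne
      subst hz
      simp only [histProbAux, if_true, mul_ne_zero_iff] at hne
      obtain ⟨⟨⟨ha, hb⟩, ht⟩, hrec⟩ := hne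
      have hbeq : b = β (pre, zs) := by
        by_contra h
        simp [h] at hb
      have hsh : shift σ pre ([], zs) = σ (pre, zs) := by simp [shift]
      have hop := optPreserving_of_optimal hP (hσ.shift pre) hst hopt
      rw [hsh] at hop
      obtain ⟨hvp, hmass⟩ := hβ' (pre, zs) (havoid zs
        ((mem_optStates_iff hP).2 ⟨_, hσ.shift pre, hopt⟩) hsT _ (hσ (pre, zs)) hop)
      rw [← hbeq] at hvp hmass
      refine hrec (ih _ _ (fun hmem => ?_) ?_)
      · have := (massOf_eq_zero_iff _ _).1 hmass _ hmem
        simp only [pA, PMF.bind_apply, ENNReal.tsum_eq_zero, mul_eq_zero] at this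
        exact (this a).elim ha ht
      · have := (val_le_expE hP (hσ.shift pre) hst hopt (hbeq ▸ hβ (pre, zs))).2
          (hsh.symm ▸ hvp) a _ (hsh.symm ▸ ha) ht
        refine this.trans_eq (congrArg (G.guarantee top · _) (funext fun h => ?_))
        simp [shift]
  refine le_antisymm (hopt.trans ((iInf₂_le _ hπ).trans ?_)) zero_le
  refine le_of_eq (ENNReal.tsum_eq_zero.2 fun l => ?_)
  rw [hzero l [] s hsT hopt, ite_self]

end Optimal

end Game

/-- An increasing chain of subsets of a finite type that starts with a nonempty set and whose next
member is determined by the current one is stationary from index `card - 1` on. -/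
theorem iterate_stationary {S : Type} [Finite S] (f : Set S → Set S) (hf : ∀ T, T ⊆ f T)
    (R : ℕ → Set S) (h0 : (R 0).Nonempty) (hsucc : ∀ n, R (n + 1) = f (R n)) :
    R (Nat.card S - 1 + 1) = R (Nat.card S - 1) := by
  have hkey : ∀ n, R (n + 1) = R n ∨ n + 2 ≤ (R (n + 1)).ncard := by
    have hlt : ∀ n, R (n + 1) ≠ R n → (R n).ncard < (R (n + 1)).ncard := fun n hn =>
      Set.ncard_lt_ncard (LE.le.ssubset_of_ne (hsucc n ▸ hf (R n)) hn.symm)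
        (Set.toFinite _)
    intro n
    induction n with
    | zero =>
      refine or_iff_not_imp_left.2 fun hn => ?_
      have h1 := hlt 0 hn
      have h2 := (Set.ncard_pos (Set.toFinite _)).2 h0
      omega
    | succ n ih =>
      refine or_iff_not_imp_left.2 fun hn => ?_
      rcases ih with ih | ih
      · exact (hn (by rw [hsucc (n + 1), ih, ← hsucc n, ih])).elim
      · have := hlt (n + 1) hn
        omega
  refine (hkey _).resolve_right fun h => ?_
  have h1 := Set.ncard_le_card (R (Nat.card S - 1 + 1))
  omega

/-- Lemma 4: R = S₀⁺, where R is the least-fixed-point-style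
iteration R(0) = {⊤}, R(n+1) adding states with an optimality-preserving mixed
action that enters R(n) with probability ≥ δ_s > 0 under every value-preserving
Min action, and S₀⁺ is the set of states with an optimal Max strategy, minus ⊥. -/
theorem stmt17 {S A B : Type} [Finite S] [Countable A] [Countable B]
    (G : Game S A B) (top bot : S) (htop : G.IsSink top) (hbot : G.IsSink bot)
    (hB : ∀ s, (G.actB s).Finite)
    (P : (Hist S A B → PMF A) → (Hist S A B → PMF B) → S →
      MeasureTheory.Measure (Play S A B))
    (hP : ∀ σ π s, G.IsMaxStrategy σ → G.IsMinStrategy π →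
      G.IsPlayMeasure σ π s (P σ π s))
    (hzero : ∀ s : S, G.val P (Reaches top) s = 0 ↔ s = bot)
    (R : ℕ → Set S) (hR0 : R 0 = {top})
    (hRsucc : ∀ n, R (n+1) = R n ∪ {s ∈ G.OptStates P top |
      ∃ α : PMF A, α.support ⊆ G.actA s ∧ G.OptPreserving P top s α ∧
        ∃ δ : ℝ≥0∞, 0 < δ ∧ ∀ b ∈ G.actB s,
          G.ValuePres P top s α b → δ ≤ massOf (G.pA s α b) (R n)}) :
    R (Nat.card S - 1) = G.OptStates P top \ {bot} := by
  have htb : top ≠ bot := by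
    rintro rfl
    exact one_ne_zero ((Game.val_self hP).symm.trans ((hzero top).2 rfl))
  have hbotstep : ∀ (α : PMF A) (b : B) (t : S), t ≠ bot → G.pA bot α b t = 0 := by
    intro α b t ht
    simp only [Game.pA, PMF.bind_apply, ENNReal.tsum_eq_zero, mul_eq_zero]
    intro a
    refine Or.inr ?_
    have := (PMF.apply_eq_one_iff _ _).1 (hbot a b)
    rw [PMF.apply_eq_zero_iff, this]
    exact ht
  have hsub : ∀ n, R n ⊆ G.OptStates P top \ {bot} := by
    intro n
    induction n with
    | zero =>
      rw [hR0, Set.singleton_subset_iff]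
      exact ⟨Game.top_mem_optStates hP, htb⟩
    | succ n ih =>
      rw [hRsucc]
      refine Set.union_subset ih ?_
      rintro s ⟨hs, α, -, -, δ, hδ, h⟩
      refine ⟨hs, ?_⟩
      rintro rfl
      obtain ⟨b, hb⟩ := G.actB_nonempty s
      have hvp : G.ValuePres P top s α b := by
        rw [Game.ValuePres, (hzero s).2 rfl, expE, ENNReal.tsum_eq_zero]
        intro t
        by_cases ht : t = s
        · simp [(hzero t).2 ht]
        · simp [hbotstep α b t ht]
      have hmass : massOf (G.pA s α b) (R n) = 0 :=
        (Game.massOf_eq_zero_iff _ _).2 fun t ht => hbotstep α b t (ih ht).2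
      exact absurd (h b hb hvp) (by simpa [hmass] using hδ.ne')
  have hmono : Monotone R := monotone_nat_of_le_succ fun n => by
    rw [hRsucc]
    exact Set.subset_union_left
  set N := Nat.card S - 1 with hN
  have hstat : R (N + 1) = R N := iterate_stationary (fun T => T ∪ {s ∈ G.OptStates P top |
      ∃ α : PMF A, α.support ⊆ G.actA s ∧ G.OptPreserving P top s α ∧
        ∃ δ : ℝ≥0∞, 0 < δ ∧ ∀ b ∈ G.actB s,
          G.ValuePres P top s α b → δ ≤ massOf (G.pA s α b) T}) (fun T => Set.subset_union_left) R (by simp [hR0]) hRsucc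
  refine (hsub N).antisymm fun s hs => ?_
  by_contra hsR
  refine hs.2 ((hzero s).1 (Game.val_eq_zero_of_avoid hP (T := R N)
    (hmono (Nat.zero_le N) (by simp [hR0])) ?_ hs.1 hsR))
  intro s hs hsR α hα hop
  by_contra! hcon
  obtain ⟨δ, hδ, h⟩ := Game.exists_pos_le_of_finite
    ((hB s).subset (Set.sep_subset _ (G.ValuePres P top s α)))
    (fun b => massOf (G.pA s α b) (R N)) fun b hb => hcon b hb.1 hb.2
  refine hsR (hstat ▸ ?_)
  rw [hRsucc]
  exact Or.inr ⟨hs, α, hα, hop, δ, hδ, fun b hb hvp => h b ⟨hb, hvp⟩⟩
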